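/- arXiv:2007.11677 — 5 statements merged into one kernel-verified Lean document; each statement's English description precedes it below -/
import Mathlib

section
/- Let C and D be real symmetric traceless 3×3 matrices and r ∈ ℝ³ a unit vector such that (C, D, r) satisfies the no-incoming-radiation relation. Then the asymptotic super-Poynting vector P, with components P_a := 2 Σ_{r',s,t} C_{r' t} D_{t s} ε_{r' s a}, satisfies Σ_a P_a r_a ≤ 0. -/
/-- The 3-dimensional Levi-Civita symbol with `eps3 0 1 2 = 1`. -/
noncomputable def eps3 (i j k : Fin 3) : ℝ :=
  (((j.val : ℝ) - i.val) * ((k.val : ℝ) - j.val) * ((k.val : ℝ) - i.val)) / 2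

/-- The asymptotic super-Poynting vector `P_a = 2 Σ C_{r't} D_{ts} ε_{r'sa}`. -/
noncomputable def superPoynting (C D : Matrix (Fin 3) (Fin 3) ℝ) (a : Fin 3) : ℝ :=
  2 * ∑ r', ∑ s, ∑ t, C r' t * D t s * eps3 r' s a

/-- The no-incoming-radiation relation between the electric part `D`, the magnetic
part `C`, and the unit vector `r`:
`D_{ab} − (1/2)(D_{ef} r^e r^f)(3 r_a r_b − δ_{ab}) = r^d ε_{ed(a}(C_{b)}{}^e + r_{b)} r^f C_f{}^e)`. -/
noncomputable def NoIncomingRadiation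
    (C D : Matrix (Fin 3) (Fin 3) ℝ) (r : Fin 3 → ℝ) : Prop :=
  ∀ a b, D a b - (1 / 2) * (∑ e, ∑ f, D e f * r e * r f) *
      (3 * r a * r b - (if a = b then 1 else 0))
    = (1 / 2) * ∑ d, ∑ e, r d *
        (eps3 e d a * (C b e + r b * ∑ f, r f * C f e) +
         eps3 e d b * (C a e + r a * ∑ f, r f * C f e))

/-- The antisymmetric matrix `J_{ab} = Σ_d ε_{abd} r_d` of the cross product with `r`. -/
noncomputable def crossMatrix (r : Fin 3 → ℝ) : Matrix (Fin 3) (Fin 3) ℝ :=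
  Matrix.of fun a b => ∑ d, eps3 a b d * r d

theorem crossMatrix_eq (r : Fin 3 → ℝ) :
    crossMatrix r = !![0, r 2, -r 1; -r 2, 0, r 0; r 1, -r 0, 0] := by
  ext a b
  fin_cases a <;> fin_cases b <;> norm_num [crossMatrix, eps3, Fin.sum_univ_three]

theorem sum_superPoynting_mul (C D : Matrix (Fin 3) (Fin 3) ℝ) (r : Fin 3 → ℝ) :
    ∑ a, superPoynting C D a * r a = 2 * ∑ a, ∑ b, (C * D) a b * crossMatrix r a b := by
  rw [crossMatrix_eq]
  simp [superPoynting, Matrix.mul_apply, Fin.sum_univ_three, eps3]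
  ring

theorem NoIncomingRadiation.apply_eq {C D : Matrix (Fin 3) (Fin 3) ℝ} {r : Fin 3 → ℝ}
    (h : NoIncomingRadiation C D r) (a b : Fin 3) :
    D a b = (1 / 2) * (∑ e, ∑ f, D e f * r e * r f) * (3 * r a * r b - if a = b then 1 else 0) +
      (1 / 2) * ∑ e, (crossMatrix r a e * (C b e + r b * ∑ f, r f * C f e) +
        crossMatrix r b e * (C a e + r a * ∑ f, r f * C f e)) := by
  rw [← sub_eq_iff_eq_add', h a b, Finset.sum_comm]
  congr 1
  refine Finset.sum_congr rfl fun e _ => ?_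
  simp only [crossMatrix, Matrix.of_apply, Finset.sum_mul, ← Finset.sum_add_distrib]
  refine Finset.sum_congr rfl fun d _ => ?_
  simp only [eps3]
  ring

/-- Under the no-incoming-radiation relation, the radial super-Poynting flux is minus a sum of
squares: those of the entries of the commutator `[C, J]` and of the vector `J C r`. -/
theorem NoIncomingRadiation.sum_superPoynting_mul_eq {C D : Matrix (Fin 3) (Fin 3) ℝ}
    {r : Fin 3 → ℝ} (h : NoIncomingRadiation C D r) (hC : C.IsSymm) :
    ∑ a, superPoynting C D a * r a =
      -((1 / 2) * ∑ a, ∑ b, (C * crossMatrix r - crossMatrix r * C) a b ^ 2 +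
        ∑ a, (crossMatrix r).mulVec (C.mulVec r) a ^ 2) := by
  have hD := h.apply_eq
  rw [sum_superPoynting_mul]
  generalize ∑ e, ∑ f, D e f * r e * r f = l at hD
  simp only [Matrix.sub_apply, Matrix.mul_apply, hD, crossMatrix_eq]
  simp [Matrix.mulVec, dotProduct, Fin.sum_univ_three,
    hC.apply 0 1, hC.apply 0 2, hC.apply 1 2]
  ring

/-- Under the no-incoming-radiation relation, the asymptotic super-Poynting vector
satisfies `P^a r_a ≤ 0`. -/
theorem superPoynting_dot_r_nonpos
    (C D : Matrix (Fin 3) (Fin 3) ℝ) (r : Fin 3 → ℝ)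
    (hC : C.IsSymm) (hCtr : Matrix.trace C = 0)
    (hD : D.IsSymm) (hDtr : Matrix.trace D = 0)
    (hr : ∑ a, r a * r a = 1)
    (hNIR : NoIncomingRadiation C D r) :
    ∑ a, superPoynting C D a * r a ≤ 0 := by
  rw [hNIR.sum_superPoynting_mul_eq hC, neg_nonpos]
  positivity
end

section
/- Let C and D be real symmetric traceless 3×3 matrices and r ∈ ℝ³ a unit vector such that (C, D, r) satisfies the no-incoming-radiation relation. Then the asymptotic super-Poynting vector P, with components P_a := 2 Σ_{r',s,t} C_{r' t} D_{t s} ε_{r' s a}, satisfies: Σ_a P_a r_a = 0 if and only if P = 0. -/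
/-- The squared norms of the transverse-traceless part of `C` and of the transverse part of `C r`
add up to `|C|² - |C r|² - (r · C r)² / 2`. -/
theorem sum_sq_transverse {C : Matrix (Fin 3) (Fin 3) ℝ} {r c : Fin 3 → ℝ} {g : ℝ}
    (hC : C.IsSymm) (hCtr : Matrix.trace C = 0) (hr : ∑ a, r a * r a = 1)
    (hc : ∀ e, c e = ∑ f, r f * C f e) (hg : g = ∑ e, r e * c e) :
    ∑ a, ∑ b, (C a b - r a * c b - c a * r b + g / 2 * (r a * r b) +
        g / 2 * (if a = b then 1 else 0)) ^ 2 + ∑ a, (c a - g * r a) ^ 2 =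
      ∑ a, ∑ b, C a b ^ 2 - ∑ a, c a ^ 2 - g ^ 2 / 2 := by
  have h₀₁ := hC.apply 0 1
  have h₀₂ := hC.apply 0 2
  have h₁₂ := hC.apply 1 2
  have h₂₂ : C 2 2 = -C 0 0 - C 1 1 := by
    rw [Matrix.trace_fin_three] at hCtr
    linarith
  have hc₀ := hc 0
  have hc₁ := hc 1
  have hc₂ := hc 2
  simp only [Fin.sum_univ_three, h₀₁, h₀₂, h₁₂, h₂₂] at hr hg hc₀ hc₁ hc₂ ⊢
  simp only [Fin.isValue, Fin.reduceEq, if_true, if_false]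
  linear_combination
    (2 * (c 0 ^ 2 + c 1 ^ 2 + c 2 ^ 2) +
      g ^ 2 * (r 0 * r 0 + r 1 * r 1 + r 2 * r 2 - 1) / 4) * hr +
    (g - 2 * (r 0 * c 0 + r 1 * c 1 + r 2 * c 2) +
      2 * g * (r 0 * r 0 + r 1 * r 1 + r 2 * r 2)) * hg +
    (4 * c 0 - g * r 0) * hc₀ + (4 * c 1 - g * r 1) * hc₁ + (4 * c 2 - g * r 2) * hc₂

/-- The radial super-Poynting component in terms of `C` alone. -/
theorem NoIncomingRadiation.sum_superPoynting_mul {C D : Matrix (Fin 3) (Fin 3) ℝ}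
    {r c : Fin 3 → ℝ} {g : ℝ} (h : NoIncomingRadiation C D r)
    (hC : C.IsSymm) (hCtr : Matrix.trace C = 0) (hr : ∑ a, r a * r a = 1)
    (hc : ∀ e, c e = ∑ f, r f * C f e) (hg : g = ∑ e, r e * c e) :
    ∑ a, superPoynting C D a * r a =
      -2 * (∑ a, ∑ b, C a b ^ 2 - ∑ a, c a ^ 2 - g ^ 2 / 2) := by
  have hD : ∀ a b, D a b = _ := fun a b => sub_eq_iff_eq_add.1 (h a b)
  generalize (∑ e, ∑ f, D e f * r e * r f) = δ at hD
  have h₀₁ := hC.apply 0 1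
  have h₀₂ := hC.apply 0 2
  have h₁₂ := hC.apply 1 2
  have h₂₂ : C 2 2 = -C 0 0 - C 1 1 := by
    rw [Matrix.trace_fin_three] at hCtr
    linarith
  simp only [superPoynting, hD, hg, hc, eps3, Fin.sum_univ_three, h₀₁, h₀₂, h₁₂, h₂₂] at hr ⊢
  simp only [Fin.isValue, Fin.reduceEq, if_true, if_false, Fin.val_zero, Fin.val_one, Fin.val_two,
    Nat.cast_zero, Nat.cast_one, Nat.cast_ofNat]
  linear_combination
    (-2 * (C 0 0 ^ 2 + C 1 1 ^ 2 + (C 0 0 + C 1 1) ^ 2 +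
        2 * (C 0 1 ^ 2 + C 0 2 ^ 2 + C 1 2 ^ 2)) -
      ((r 0 * C 0 0 + r 1 * C 0 1 + r 2 * C 0 2) ^ 2 +
        (r 0 * C 0 1 + r 1 * C 1 1 + r 2 * C 1 2) ^ 2 +
        (r 0 * C 0 2 + r 1 * C 1 2 + r 2 * (-C 0 0 - C 1 1)) ^ 2)) * hr

/-- If `C` is axially symmetric about `r`, then so is `D`, and the super-Poynting vector
vanishes. -/
theorem NoIncomingRadiation.superPoynting_eq_zero {C D : Matrix (Fin 3) (Fin 3) ℝ}
    {r : Fin 3 → ℝ} {g : ℝ} (h : NoIncomingRadiation C D r)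
    (hC : ∀ a b, C a b = g / 2 * (3 * r a * r b - if a = b then 1 else 0))
    (hc : ∀ e, ∑ f, r f * C f e = g * r e) (a : Fin 3) : superPoynting C D a = 0 := by
  have hD : ∀ a b, D a b = _ := fun a b => sub_eq_iff_eq_add.1 (h a b)
  generalize (∑ e, ∑ f, D e f * r e * r f) = δ at hD
  simp only [superPoynting, hD, hc]
  simp only [hC, eps3, Fin.sum_univ_three]
  fin_cases a <;>
  · simp only [Fin.isValue, Fin.reduceEq, if_true, if_false, Fin.val_zero, Fin.val_one,
      Fin.val_two, Nat.cast_zero, Nat.cast_one, Nat.cast_ofNat, Fin.zero_eta, Fin.mk_one,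
      Fin.reduceFinMk]
    ring

/-- Under the no-incoming-radiation relation, the radial component of the asymptotic
super-Poynting vector vanishes iff the whole super-Poynting vector vanishes. -/
theorem superPoynting_dot_r_eq_zero_iff
    (C D : Matrix (Fin 3) (Fin 3) ℝ) (r : Fin 3 → ℝ)
    (hC : C.IsSymm) (hCtr : Matrix.trace C = 0)
    (hD : D.IsSymm) (hDtr : Matrix.trace D = 0)
    (hr : ∑ a, r a * r a = 1)
    (hNIR : NoIncomingRadiation C D r) :
    (∑ a, superPoynting C D a * r a = 0) ↔ ∀ a, superPoynting C D a = 0 := by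
  refine ⟨fun h => ?_, fun h => by simp [h]⟩
  obtain ⟨c, hc⟩ : ∃ c : Fin 3 → ℝ, ∀ e, c e = ∑ f, r f * C f e := ⟨_, fun _ => rfl⟩
  obtain ⟨g, hg⟩ : ∃ g, g = ∑ e, r e * c e := ⟨_, rfl⟩
  rw [hNIR.sum_superPoynting_mul hC hCtr hr hc hg, ← sum_sq_transverse hC hCtr hr hc hg] at h
  have hE := Finset.sum_nonneg fun a (_ : a ∈ Finset.univ) => Finset.sum_nonneg
    fun b (_ : b ∈ Finset.univ) => sq_nonneg (C a b - r a * c b - c a * r b +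
      g / 2 * (r a * r b) + g / 2 * (if a = b then 1 else 0))
  have hw := Finset.sum_nonneg fun a (_ : a ∈ Finset.univ) => sq_nonneg (c a - g * r a)
  have hE₀ := le_antisymm (by linarith) hE
  have hw₀ := le_antisymm (by linarith) hw
  have hcr : ∀ e, c e = g * r e := fun e => sub_eq_zero.1 <| pow_eq_zero_iff two_ne_zero |>.1 <|
    (Finset.sum_eq_zero_iff_of_nonneg fun _ _ => sq_nonneg _).1 hw₀ e (Finset.mem_univ e)
  refine hNIR.superPoynting_eq_zero (g := g) (fun a b => ?_) fun e => (hc e).symm.trans (hcr e)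
  have hab := pow_eq_zero_iff two_ne_zero |>.1 <|
    (Finset.sum_eq_zero_iff_of_nonneg fun _ _ => sq_nonneg _).1
      ((Finset.sum_eq_zero_iff_of_nonneg fun _ _ => Finset.sum_nonneg fun _ _ => sq_nonneg _).1
        hE₀ a (Finset.mem_univ a)) b (Finset.mem_univ b)
  rw [hcr, hcr] at hab
  linear_combination hab
end

section
/- Let W be a Weyl candidate on Minkowski ℝ⁴ and T its Bel–Robinson tensor. Then T is totally symmetric (T_{αβγδ} is invariant under every permutation of its four indices) and traceless (Σ_{α,β} η^{αβ} T_{αβγδ} = 0 for all γ, δ). -/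
/-- The Minkowski metric `η = diag(−1,1,1,1)` on `ℝ⁴` (equal to its inverse). -/
noncomputable def η (α β : Fin 4) : ℝ :=
  if α = β then (if α = 0 then -1 else 1) else 0

/-- The 4-dimensional Levi-Civita symbol with `eps4 0 1 2 3 = 1`. -/
noncomputable def eps4 (a b c d : Fin 4) : ℝ :=
  (((b.val : ℝ) - a.val) * ((c.val : ℝ) - a.val) * ((d.val : ℝ) - a.val) *
   ((c.val : ℝ) - b.val) * ((d.val : ℝ) - b.val) * ((d.val : ℝ) - c.val)) / 12

/-- A Weyl candidate: a 4-index array with the algebraic symmetries, first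
Bianchi identity and tracelessness of a Weyl tensor. -/
noncomputable def IsWeylCandidate (W : Fin 4 → Fin 4 → Fin 4 → Fin 4 → ℝ) : Prop :=
  (∀ α β γ δ, W α β γ δ = - W β α γ δ) ∧
  (∀ α β γ δ, W α β γ δ = - W α β δ γ) ∧
  (∀ α β γ δ, W α β γ δ = W γ δ α β) ∧
  (∀ α β γ δ, W α β γ δ + W α γ δ β + W α δ β γ = 0) ∧
  (∀ β δ, ∑ α, ∑ γ, η α γ * W α β γ δ = 0)

/-- The Hodge dual `(*W)_{αβγδ} = (1/2) ε_{αβμν} η^{μρ} η^{νσ} W_{ρσγδ}`. -/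
noncomputable def dual (W : Fin 4 → Fin 4 → Fin 4 → Fin 4 → ℝ)
    (α β γ δ : Fin 4) : ℝ :=
  (1 / 2) * ∑ μ, ∑ ν, ∑ ρ, ∑ σ, eps4 α β μ ν * η μ ρ * η ν σ * W ρ σ γ δ

/-- The Bel–Robinson tensor
`T_{αβγδ} = η^{μμ'} η^{νν'} (W_{αμγν} W_{δν'βμ'} + (*W)_{αμγν} (*W)_{δν'βμ'})`. -/
noncomputable def BR (W : Fin 4 → Fin 4 → Fin 4 → Fin 4 → ℝ)
    (α β γ δ : Fin 4) : ℝ :=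
  ∑ μ, ∑ μ', ∑ ν, ∑ ν', η μ μ' * η ν ν' *
    (W α μ γ ν * W δ ν' β μ' + dual W α μ γ ν * dual W δ ν' β μ')

/-- The Minkowski Hodge dual of a 2-form. -/
noncomputable def hodge (A : Fin 4 → Fin 4 → ℝ) (α β : Fin 4) : ℝ :=
  (1 / 2) * ∑ μ, ∑ ν, ∑ ρ, ∑ σ, eps4 α β μ ν * η μ ρ * η ν σ * A ρ σ

/-- The diagonal entries of the Minkowski metric. -/
def minkowskiSign (μ : Fin 4) : ℝ := if μ = 0 then -1 else 1

lemma sum_η_mul (μ : Fin 4) (f : Fin 4 → ℝ) : ∑ ν, η μ ν * f ν = minkowskiSign μ * f μ := by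
  simp [η, minkowskiSign]

lemma hodge_eq (A : Fin 4 → Fin 4 → ℝ) (α β : Fin 4) :
    hodge A α β = (1 / 2) * ∑ μ, ∑ ν,
      eps4 α β μ ν * (minkowskiSign μ * (minkowskiSign ν * A μ ν)) := by
  unfold hodge
  congr 1
  refine Finset.sum_congr rfl fun μ _ => Finset.sum_congr rfl fun ν _ => ?_
  simp only [mul_assoc, ← Finset.mul_sum, sum_η_mul]

lemma hodge_antisymm (A : Fin 4 → Fin 4 → ℝ) (α β : Fin 4) :
    hodge A α β = -hodge A β α := by
  have h : ∀ μ ν, eps4 α β μ ν = -eps4 β α μ ν := fun μ ν => by unfold eps4; ring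
  simp only [hodge_eq, h, neg_mul, Finset.sum_neg_distrib, mul_neg]

lemma hodge_components {A : Fin 4 → Fin 4 → ℝ} (hA : ∀ α β, A α β = -A β α) :
    hodge A 0 1 = A 2 3 ∧ hodge A 0 2 = -A 1 3 ∧ hodge A 0 3 = A 1 2 ∧
    hodge A 1 2 = -A 0 3 ∧ hodge A 1 3 = A 0 2 ∧ hodge A 2 3 = -A 0 1 := by
  have h10 := hA 1 0
  have h20 := hA 2 0
  have h30 := hA 3 0
  have h21 := hA 2 1
  have h31 := hA 3 1
  have h32 := hA 3 2
  refine ⟨?_, ?_, ?_, ?_, ?_, ?_⟩ <;>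
  · simp [hodge_eq, Fin.sum_univ_four, eps4, minkowskiSign, h10, h20, h30, h21, h31, h32]
    ring

/-- The contraction `A_{αμ} B_β^μ + (*A)_{αμ} (*B)_β^μ` of two 2-forms is symmetric. -/
lemma stress_symm {A B : Fin 4 → Fin 4 → ℝ} (hA : ∀ α β, A α β = -A β α)
    (hB : ∀ α β, B α β = -B β α) (α β : Fin 4) :
    ∑ μ, minkowskiSign μ * (A α μ * B β μ + hodge A α μ * hodge B β μ) =
      ∑ μ, minkowskiSign μ * (A β μ * B α μ + hodge A β μ * hodge B α μ) := by
  obtain ⟨a1, a2, a3, a4, a5, a6⟩ := hodge_components hA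
  obtain ⟨b1, b2, b3, b4, b5, b6⟩ := hodge_components hB
  have zero {C : Fin 4 → Fin 4 → ℝ} (hC : ∀ α β, C α β = -C β α) (i) : C i i = 0 := by
    linarith [hC i i]
  have hA' := hodge_antisymm A
  have hB' := hodge_antisymm B
  fin_cases α <;> fin_cases β <;>
  · simp [Fin.sum_univ_four, minkowskiSign, zero hA, zero hB, zero hA', zero hB',
      hA 1 0, hA 2 0, hA 3 0, hA 2 1, hA 3 1, hA 3 2, hB 1 0, hB 2 0, hB 3 0, hB 2 1, hB 3 1,
      hB 3 2, hA' 1 0, hA' 2 0, hA' 3 0, hA' 2 1, hA' 3 1, hA' 3 2, hB' 1 0, hB' 2 0, hB' 3 0,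
      hB' 2 1, hB' 3 1, hB' 3 2, a1, a2, a3, a4, a5, a6, b1, b2, b3, b4, b5, b6]
    try ring

/-- The Hodge dual is anti-isometric for the Lorentzian inner product of 2-forms. -/
lemma inner_hodge {A B : Fin 4 → Fin 4 → ℝ} (hA : ∀ α β, A α β = -A β α)
    (hB : ∀ α β, B α β = -B β α) :
    ∑ α, ∑ μ, minkowskiSign α * (minkowskiSign μ *
      (A α μ * B α μ + hodge A α μ * hodge B α μ)) = 0 := by
  obtain ⟨a1, a2, a3, a4, a5, a6⟩ := hodge_components hA
  obtain ⟨b1, b2, b3, b4, b5, b6⟩ := hodge_components hB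
  have zero {C : Fin 4 → Fin 4 → ℝ} (hC : ∀ α β, C α β = -C β α) (i) : C i i = 0 := by
    linarith [hC i i]
  have hA' := hodge_antisymm A
  have hB' := hodge_antisymm B
  simp [Fin.sum_univ_four, minkowskiSign, zero hA, zero hB, zero hA', zero hB',
      hA 1 0, hA 2 0, hA 3 0, hA 2 1, hA 3 1, hA 3 2, hB 1 0, hB 2 0, hB 3 0, hB 2 1, hB 3 1,
      hB 3 2, hA' 1 0, hA' 2 0, hA' 3 0, hA' 2 1, hA' 3 1, hA' 3 2, hB' 1 0, hB' 2 0, hB' 3 0,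
      hB' 2 1, hB' 3 1, hB' 3 2, a1, a2, a3, a4, a5, a6, b1, b2, b3, b4, b5, b6]
  ring

lemma dual_eq_hodge (W : Fin 4 → Fin 4 → Fin 4 → Fin 4 → ℝ) (α β γ δ : Fin 4) :
    dual W α β γ δ = hodge (fun μ ν => W μ ν γ δ) α β := rfl

lemma BR_eq (W : Fin 4 → Fin 4 → Fin 4 → Fin 4 → ℝ) (α β γ δ : Fin 4) :
    BR W α β γ δ = ∑ μ, ∑ ν, minkowskiSign μ * (minkowskiSign ν *
      (W α μ γ ν * W δ ν β μ + dual W α μ γ ν * dual W δ ν β μ)) := by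
  unfold BR
  refine Finset.sum_congr rfl fun μ _ => ?_
  rw [Finset.sum_comm]
  refine Finset.sum_congr rfl fun ν _ => ?_
  simp only [mul_assoc, ← Finset.mul_sum, sum_η_mul]

namespace IsWeylCandidate

variable {W : Fin 4 → Fin 4 → Fin 4 → Fin 4 → ℝ}

lemma trace_eq_zero (hW : IsWeylCandidate W) (β δ : Fin 4) :
    -W 0 β 0 δ + W 1 β 1 δ + W 2 β 2 δ + W 3 β 3 δ = 0 := by
  have h := hW.2.2.2.2 β δ
  simp only [sum_η_mul] at h
  simpa [Fin.sum_univ_four, minkowskiSign] using h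

lemma dual_components (hW : IsWeylCandidate W) (γ δ : Fin 4) :
    dual W 0 1 γ δ = W 2 3 γ δ ∧ dual W 0 2 γ δ = -W 1 3 γ δ ∧ dual W 0 3 γ δ = W 1 2 γ δ ∧
    dual W 1 2 γ δ = -W 0 3 γ δ ∧ dual W 1 3 γ δ = W 0 2 γ δ ∧ dual W 2 3 γ δ = -W 0 1 γ δ :=
  hodge_components fun α β => hW.1 α β γ δ

lemma dual_antisymm_left (W : Fin 4 → Fin 4 → Fin 4 → Fin 4 → ℝ) (α β γ δ : Fin 4) :
    dual W α β γ δ = -dual W β α γ δ := hodge_antisymm _ α β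

lemma dual_antisymm_right (hW : IsWeylCandidate W) (α β γ δ : Fin 4) :
    dual W α β γ δ = -dual W α β δ γ := by
  simp only [dual, hW.2.1 _ _ γ δ, mul_neg, Finset.sum_neg_distrib]

lemma dual_pair_symm (hW : IsWeylCandidate W) (α β γ δ : Fin 4) :
    dual W α β γ δ = dual W γ δ α β := by
  have hl := dual_antisymm_left W
  have hr := hW.dual_antisymm_right
  have key : ∀ α β γ δ : Fin 4, α < β → γ < δ → dual W α β γ δ = dual W γ δ α β := by
    intro α β γ δ h₁ h₂
    obtain ⟨w1, w2, w3, -⟩ := id hW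
    have c := hW.dual_components
    have zero (i γ δ) : W i i γ δ = 0 := by linarith [w1 i i γ δ]
    have zero' (α β i) : W α β i i = 0 := by linarith [w2 α β i i]
    have t := hW.trace_eq_zero
    have t00 := t 0 0
    have t01 := t 0 1
    have t02 := t 0 2
    have t03 := t 0 3
    have t11 := t 1 1
    have t12 := t 1 2
    have t13 := t 1 3
    have t22 := t 2 2
    have t23 := t 2 3
    have t33 := t 3 3
    simp only [zero, zero', w1 1 0, w1 2 0, w1 3 0, w1 2 1, w1 3 1, w1 3 2, w2 _ _ 1 0,
      w2 _ _ 2 0, w2 _ _ 3 0, w2 _ _ 2 1, w2 _ _ 3 1, w2 _ _ 3 2]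
      at t00 t01 t02 t03 t11 t12 t13 t22 t23 t33
    fin_cases α <;> fin_cases β <;> try exact absurd h₁ (by decide)
    all_goals fin_cases γ <;> fin_cases δ <;> try exact absurd h₂ (by decide)
    all_goals
      simp only [Fin.zero_eta, Fin.mk_one, Fin.reduceFinMk, c] <;>
      linarith [w3 0 1 0 2, w3 0 1 0 3, w3 0 1 1 2, w3 0 1 1 3, w3 0 1 2 3, w3 0 2 0 3,
        w3 0 2 1 2, w3 0 2 1 3, w3 0 2 2 3, w3 0 3 1 2, w3 0 3 1 3, w3 0 3 2 3, w3 1 2 1 3,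
        w3 1 2 2 3, w3 1 3 2 3]
  have zl (i γ δ) : dual W i i γ δ = 0 := by linarith [hl i i γ δ]
  have zr (α β i) : dual W α β i i = 0 := by linarith [hr α β i i]
  rcases lt_trichotomy α β with h | rfl | h <;> rcases lt_trichotomy γ δ with h' | rfl | h'
  · exact key _ _ _ _ h h'
  · rw [zl, zr]
  · rw [hr, key _ _ _ _ h h', ← hl]
  · rw [zl, zr]
  · rw [zl, zr]
  · rw [zl, zr]
  · rw [hl, key _ _ _ _ h h', ← hr]
  · rw [zl, zr]
  · rw [hl, hr, key _ _ _ _ h h', ← hr, ← hl]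

lemma dual_bianchi (hW : IsWeylCandidate W) (α β γ δ : Fin 4) :
    dual W α β γ δ + dual W α γ δ β + dual W α δ β γ = 0 := by
  have hl := dual_antisymm_left W
  have hr := hW.dual_antisymm_right
  have hp := hW.dual_pair_symm
  have zl (i γ δ) : dual W i i γ δ = 0 := by linarith [hl i i γ δ]
  have zr (α β i) : dual W α β i i = 0 := by linarith [hr α β i i]
  have key : dual W 0 1 2 3 + dual W 0 2 3 1 + dual W 0 3 1 2 = 0 := by
    have t := hW.trace_eq_zero
    obtain ⟨w1, w2, -⟩ := id hW
    have sq (i j) : W i j i j = W j i j i := by rw [w1, w2, neg_neg]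
    have zero (i γ δ) : W i i γ δ = 0 := by linarith [w1 i i γ δ]
    simp only [hW.dual_components, w2 1 3 3 1]
    linarith [t 0 0, t 1 1, t 2 2, t 3 3, sq 0 1, sq 0 2, sq 0 3, sq 1 2, sq 1 3, sq 2 3,
      zero 0 0 0, zero 1 1 1, zero 2 2 2, zero 3 3 3]
  by_cases h : α = β ∨ α = γ ∨ α = δ ∨ β = γ ∨ β = δ ∨ γ = δ
  · rcases h with rfl | rfl | rfl | rfl | rfl | rfl
    · linarith [zl α γ δ, hp α γ δ α, hl δ α α γ, hr α δ α γ]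
    · linarith [zl α δ β, hp α β α δ, hr α δ β α]
    · linarith [zl α β γ, hp α β γ α, hl γ α α β]
    · linarith [zr α δ β, hr α β β δ]
    · linarith [zr α γ β, hr α β γ β]
    · linarith [zr α β γ, hr α γ γ β]
  · rw [hr 0 2 3 1] at key
    fin_cases α <;> fin_cases β <;> fin_cases γ <;> fin_cases δ <;>
      try exact absurd (by decide) h
    all_goals
      simp only [Fin.zero_eta, Fin.mk_one, Fin.reduceFinMk, hl 1 0, hl 2 0, hl 3 0, hl 2 1, hl 3 1,
        hl 3 2, hr _ _ 1 0, hr _ _ 2 0, hr _ _ 3 0, hr _ _ 2 1, hr _ _ 3 1, hr _ _ 3 2,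
        hp 2 3 0 1, hp 1 3 0 2, hp 1 2 0 3]
      linarith

lemma BR_swap_left (hW : IsWeylCandidate W) (α β γ δ : Fin 4) :
    BR W α β γ δ = BR W β α γ δ := by
  have h (α β) : BR W α β γ δ = ∑ ν, minkowskiSign ν * ∑ μ, minkowskiSign μ *
      (W α μ γ ν * W β μ δ ν + dual W α μ γ ν * dual W β μ δ ν) := by
    rw [BR_eq, Finset.sum_comm]
    refine Finset.sum_congr rfl fun ν _ => ?_
    rw [Finset.mul_sum]
    refine Finset.sum_congr rfl fun μ _ => ?_
    rw [hW.2.2.1 δ ν β μ, hW.dual_pair_symm δ ν β μ]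
    ring
  rw [h, h]
  refine Finset.sum_congr rfl fun ν _ => congrArg _ ?_
  have := stress_symm (A := fun a b => W a b γ ν) (B := fun a b => W a b δ ν)
    (fun a b => hW.1 a b γ ν) (fun a b => hW.1 a b δ ν) α β
  exact this

lemma BR_swap_pairs (hW : IsWeylCandidate W) (α β γ δ : Fin 4) :
    BR W α β γ δ = BR W γ δ α β := by
  rw [BR_eq, BR_eq, Finset.sum_comm]
  refine Finset.sum_congr rfl fun ν _ => Finset.sum_congr rfl fun μ _ => ?_
  rw [hW.2.2.1 γ ν α μ, hW.2.2.1 β μ δ ν, hW.dual_pair_symm γ ν α μ, hW.dual_pair_symm β μ δ ν]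
  ring

lemma BR_swap_right (hW : IsWeylCandidate W) (α β γ δ : Fin 4) :
    BR W α β γ δ = BR W α β δ γ := by
  rw [hW.BR_swap_pairs, hW.BR_swap_left, hW.BR_swap_pairs]

lemma BR_swap_outer (hW : IsWeylCandidate W) (α β γ δ : Fin 4) :
    BR W α β γ δ = BR W γ β α δ := by
  obtain ⟨w1, w2, w3, w4, -⟩ := id hW
  have d1 := dual_antisymm_left W
  have d2 := hW.dual_antisymm_right
  have d3 := hW.dual_pair_symm
  have d4 := hW.dual_bianchi
  have bw (μ ν) : W δ ν β μ - W δ μ β ν = W β δ μ ν := by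
    linarith [w4 β δ μ ν, w3 δ ν β μ, w3 δ μ β ν, w2 β μ ν δ]
  have bd (μ ν) : dual W δ ν β μ - dual W δ μ β ν = dual W β δ μ ν := by
    linarith [d4 β δ μ ν, d3 δ ν β μ, d3 δ μ β ν, d2 β μ ν δ]
  have cw (μ ν) : W α μ γ ν - W α ν γ μ = W α γ μ ν := by
    linarith [w4 α γ μ ν, w2 α μ ν γ]
  have cd (μ ν) : dual W α μ γ ν - dual W α ν γ μ = dual W α γ μ ν := by
    linarith [d4 α γ μ ν, d2 α μ ν γ]
  have h₁ : BR W γ β α δ = ∑ μ, ∑ ν, minkowskiSign μ * (minkowskiSign ν *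
      (W α μ γ ν * W δ μ β ν + dual W α μ γ ν * dual W δ μ β ν)) := by
    rw [BR_eq, Finset.sum_comm]
    refine Finset.sum_congr rfl fun μ _ => Finset.sum_congr rfl fun ν _ => ?_
    rw [w3 γ ν α μ, d3 γ ν α μ]
    ring
  have h₂ : BR W α β γ δ - BR W γ β α δ = ∑ μ, ∑ ν, minkowskiSign μ * (minkowskiSign ν *
      (W α μ γ ν * W β δ μ ν + dual W α μ γ ν * dual W β δ μ ν)) := by
    rw [h₁, BR_eq]
    simp only [← Finset.sum_sub_distrib, ← bw, ← bd]
    refine Finset.sum_congr rfl fun μ _ => Finset.sum_congr rfl fun ν _ => ?_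
    ring
  have h₃ : BR W α β γ δ - BR W γ β α δ = ∑ μ, ∑ ν, minkowskiSign μ * (minkowskiSign ν *
      (-(W α ν γ μ * W β δ μ ν) - dual W α ν γ μ * dual W β δ μ ν)) := by
    rw [h₂, Finset.sum_comm]
    refine Finset.sum_congr rfl fun μ _ => Finset.sum_congr rfl fun ν _ => ?_
    rw [w2 β δ ν μ, d2 β δ ν μ]
    ring
  have h₄ : (BR W α β γ δ - BR W γ β α δ) + (BR W α β γ δ - BR W γ β α δ) = 0 := by
    nth_rewrite 1 [h₂]
    rw [h₃]
    simp only [← Finset.sum_add_distrib]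
    refine Eq.trans ?_ (inner_hodge (A := fun μ ν => W μ ν α γ) (B := fun μ ν => W μ ν β δ)
      (fun μ ν => w1 μ ν α γ) (fun μ ν => w1 μ ν β δ))
    refine Finset.sum_congr rfl fun μ _ => Finset.sum_congr rfl fun ν _ => ?_
    rw [← dual_eq_hodge, ← dual_eq_hodge, w3 μ ν α γ, w3 μ ν β δ, d3 μ ν α γ, d3 μ ν β δ,
      ← cw, ← cd]
    ring
  linarith

lemma BR_traceless (hW : IsWeylCandidate W) (γ δ : Fin 4) :
    ∑ α, ∑ β, η α β * BR W α β γ δ = 0 := by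
  simp only [sum_η_mul]
  simp only [BR_eq, Finset.mul_sum]
  rw [Finset.sum_congr rfl fun α _ => Finset.sum_comm, Finset.sum_comm]
  refine Finset.sum_eq_zero fun ν _ => ?_
  have := inner_hodge (A := fun a b => W a b γ ν) (B := fun a b => W a b δ ν)
    (fun a b => hW.1 a b γ ν) (fun a b => hW.1 a b δ ν)
  rw [← mul_zero (minkowskiSign ν), ← this]
  simp only [Finset.mul_sum]
  refine Finset.sum_congr rfl fun α _ => Finset.sum_congr rfl fun μ _ => ?_
  rw [← dual_eq_hodge, ← dual_eq_hodge, hW.2.2.1 δ ν α μ, hW.dual_pair_symm δ ν α μ]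
  ring

end IsWeylCandidate

/-- The Bel–Robinson tensor of a Weyl candidate is totally symmetric (invariant
under every permutation of its four indices) and traceless. -/
theorem BR_totallySymmetric_traceless
    (W : Fin 4 → Fin 4 → Fin 4 → Fin 4 → ℝ) (hW : IsWeylCandidate W) :
    (∀ (σ : Equiv.Perm (Fin 4)) (v : Fin 4 → Fin 4),
      BR W (v (σ 0)) (v (σ 1)) (v (σ 2)) (v (σ 3)) = BR W (v 0) (v 1) (v 2) (v 3)) ∧
    (∀ γ δ, ∑ α, ∑ β, η α β * BR W α β γ δ = 0) := by
  refine ⟨fun σ v => ?_, hW.BR_traceless⟩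
  have h₁ := hW.BR_swap_left
  have h₂ (α β γ δ) : BR W α β γ δ = BR W α γ β δ := by
    rw [h₁, hW.BR_swap_outer, h₁]
  have h₃ := hW.BR_swap_right
  have gen : ∀ i : Fin 3, ∀ u : Fin 4 → Fin 4,
      BR W (u (Equiv.swap i.castSucc i.succ 0)) (u (Equiv.swap i.castSucc i.succ 1))
        (u (Equiv.swap i.castSucc i.succ 2)) (u (Equiv.swap i.castSucc i.succ 3)) =
      BR W (u 0) (u 1) (u 2) (u 3) := by
    intro i u
    fin_cases i
    · exact h₁ _ _ _ _
    · exact h₂ _ _ _ _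
    · exact h₃ _ _ _ _
  have hσ : σ ∈ Submonoid.closure
      (Set.range fun i : Fin 3 => Equiv.swap i.castSucc i.succ) := by
    rw [Equiv.Perm.mclosure_swap_castSucc_succ]
    trivial
  induction hσ using Submonoid.closure_induction generalizing v with
  | mem τ hτ =>
    obtain ⟨i, rfl⟩ := hτ
    exact gen i v
  | one => rfl
  | mul τ τ' _ _ h h' => exact (h' (v ∘ τ)).trans (h v)
end

section
/- Let W be a Weyl candidate on Minkowski ℝ⁴ and T its Bel–Robinson tensor. Let v ∈ ℝ⁴ be a unit future-pointing timelike vector: Σ_{α,β} η_{αβ} v^α v^β = −1 and v⁰ > 0. Then the supermomentum P^α := −Σ_{α',β,γ,δ} η^{αα'} T_{α'βγδ} v^β v^γ v^δ is causal and future-pointing: Σ_{α,β} η_{αβ} P^α P^β ≤ 0 and Σ_{α,β} η_{αβ} P^α v^β ≤ 0. -/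
/-- The supermomentum `P^α = −η^{αα'} T_{α'βγδ} v^β v^γ v^δ` relative to `v`. -/
noncomputable def supermomentum (W : Fin 4 → Fin 4 → Fin 4 → Fin 4 → ℝ)
    (v : Fin 4 → ℝ) (α : Fin 4) : ℝ :=
  -∑ α', ∑ β, ∑ γ, ∑ δ, η α α' * BR W α' β γ δ * v β * v γ * v δ

/-- The Hodge dual `(*F)_{αβ} = (1/2) ε_{αβμν} F^{μν}` of a 2-form. -/
noncomputable def dualForm (F : Fin 4 → Fin 4 → ℝ) (α β : Fin 4) : ℝ :=
  (1 / 2) * ∑ μ, ∑ ν, ∑ ρ, ∑ σ, eps4 α β μ ν * η μ ρ * η ν σ * F ρ σ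

/-- The Maxwell energy-momentum vector of a 2-form `F` seen by the observer `v`. -/
noncomputable def maxwellMomentum (F : Fin 4 → Fin 4 → ℝ) (v : Fin 4 → ℝ) (α : Fin 4) : ℝ :=
  -∑ α', ∑ β, ∑ μ, ∑ μ', η α α' * η μ μ' *
    (F α' μ * F β μ' + dualForm F α' μ * dualForm F β μ') * v β

theorem sum_eta_mul (f : Fin 4 → Fin 4 → ℝ) :
    ∑ α, ∑ β, η α β * f α β = -f 0 0 + f 1 1 + f 2 2 + f 3 3 := by
  simp [Fin.sum_univ_four, η]

theorem sum_eta_mul_mul (f g : Fin 4 → ℝ) :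
    ∑ α, ∑ β, η α β * f α * g β = -(f 0 * g 0) + f 1 * g 1 + f 2 * g 2 + f 3 * g 3 := by
  simp [Fin.sum_univ_four, η]

theorem dualForm_eq (F : Fin 4 → Fin 4 → ℝ) (hF : ∀ α β, F α β = -F β α) :
    dualForm F = ![![0, F 2 3, -F 1 3, F 1 2], ![-F 2 3, 0, -F 0 3, F 0 2],
      ![F 1 3, F 0 3, 0, -F 0 1], ![-F 1 2, -F 0 2, F 0 1, 0]] := by
  have h10 := hF 1 0
  have h20 := hF 2 0
  have h30 := hF 3 0
  have h21 := hF 2 1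
  have h31 := hF 3 1
  have h32 := hF 3 2
  funext α β
  fin_cases α <;> fin_cases β <;>
    simp [dualForm, Fin.sum_univ_four, η, eps4, h10, h20, h30, h21, h31, h32] <;> ring

theorem dual_eq_dualForm (W : Fin 4 → Fin 4 → Fin 4 → Fin 4 → ℝ) (α β γ δ : Fin 4) :
    dual W α β γ δ = dualForm (fun ρ σ => W ρ σ γ δ) α β := rfl

set_option maxHeartbeats 2000000 in
theorem IsWeylCandidate.dual_pair_symm_s7 {W : Fin 4 → Fin 4 → Fin 4 → Fin 4 → ℝ}
    (hW : IsWeylCandidate W) (α β γ δ : Fin 4) : dual W α β γ δ = dual W γ δ α β := by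
  obtain ⟨h1, h2, h3, h4, h5⟩ := hW
  have hd : ∀ γ δ, dualForm (fun ρ σ => W ρ σ γ δ) = _ :=
    fun γ δ => dualForm_eq _ fun α β => h1 α β γ δ
  have hl : ∀ α γ δ, W α α γ δ = 0 := fun α γ δ => self_eq_neg.mp (h1 α α γ δ)
  have hr : ∀ α β γ, W α β γ γ = 0 := fun α β γ => self_eq_neg.mp (h2 α β γ γ)
  have l10 := h1 1 0
  have l20 := h1 2 0
  have l30 := h1 3 0
  have l21 := h1 2 1
  have l31 := h1 3 1
  have l32 := h1 3 2
  have r10 := fun α β => h2 α β 1 0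
  have r20 := fun α β => h2 α β 2 0
  have r30 := fun α β => h2 α β 3 0
  have r21 := fun α β => h2 α β 2 1
  have r31 := fun α β => h2 α β 3 1
  have r32 := fun α β => h2 α β 3 2
  have s01 := h3 0 1
  have s02 := h3 0 2
  have s03 := h3 0 3
  have s12 := h3 1 2
  have s13 := h3 1 3
  have hb := h4 0 1 2 3
  have t00 := h5 0 0
  have t01 := h5 0 1
  have t02 := h5 0 2
  have t03 := h5 0 3
  have t11 := h5 1 1
  have t12 := h5 1 2
  have t13 := h5 1 3
  have t22 := h5 2 2
  have t23 := h5 2 3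
  have t33 := h5 3 3
  simp only [sum_eta_mul, hl, hr, l10, l20, l30, l21, l31, l32, r10, r20, r30, r21, r31, r32]
    at hb t00 t01 t02 t03 t11 t12 t13 t22 t23 t33
  clear h1 h2 h3 h4 h5
  simp only [dual_eq_dualForm, hd]
  clear hd
  fin_cases α <;> fin_cases β <;> fin_cases γ <;> fin_cases δ <;>
    simp [hr, r10, r20, r30, r21, r31, r32] <;>
    linarith [s01 0 2, s01 0 3, s01 1 2, s01 1 3, s01 2 3, s02 0 3, s02 1 2, s02 1 3, s02 2 3,
      s03 1 2, s03 1 3, s03 2 3, s12 1 3, s12 2 3, s13 2 3]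

theorem maxwellMomentum_inner_self_nonpos (F : Fin 4 → Fin 4 → ℝ)
    (hF : ∀ α β, F α β = -F β α) (v : Fin 4 → ℝ)
    (hv : ∑ α, ∑ β, η α β * v α * v β = -1) :
    ∑ α, ∑ β, η α β * maxwellMomentum F v α * maxwellMomentum F v β ≤ 0 := by
  have h00 : F 0 0 = 0 := by linarith [hF 0 0]
  have h11 : F 1 1 = 0 := by linarith [hF 1 1]
  have h22 : F 2 2 = 0 := by linarith [hF 2 2]
  have h33 : F 3 3 = 0 := by linarith [hF 3 3]
  rw [sum_eta_mul_mul] at hv ⊢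
  have key : -(maxwellMomentum F v 0 * maxwellMomentum F v 0) +
      maxwellMomentum F v 1 * maxwellMomentum F v 1 +
      maxwellMomentum F v 2 * maxwellMomentum F v 2 +
      maxwellMomentum F v 3 * maxwellMomentum F v 3 =
      (-(v 0 * v 0) + v 1 * v 1 + v 2 * v 2 + v 3 * v 3) *
      ((F 0 1 ^ 2 + F 0 2 ^ 2 + F 0 3 ^ 2 - F 2 3 ^ 2 - F 1 3 ^ 2 - F 1 2 ^ 2) ^ 2 +
        4 * (F 0 1 * F 2 3 - F 0 2 * F 1 3 + F 0 3 * F 1 2) ^ 2) := by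
    simp [maxwellMomentum, dualForm_eq F hF, Fin.sum_univ_four, η, h00, h11, h22, h33,
      hF 1 0, hF 2 0, hF 3 0, hF 2 1, hF 3 1, hF 3 2]
    ring
  rw [key, hv]
  nlinarith [sq_nonneg (F 0 1 ^ 2 + F 0 2 ^ 2 + F 0 3 ^ 2 - F 2 3 ^ 2 - F 1 3 ^ 2 - F 1 2 ^ 2),
    sq_nonneg (F 0 1 * F 2 3 - F 0 2 * F 1 3 + F 0 3 * F 1 2)]

/-- A vector orthogonal to a timelike vector is spacelike. -/
theorem sq_le_of_orthogonal_timelike {a b c d v₀ v₁ v₂ v₃ : ℝ}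
    (hv : -(v₀ * v₀) + v₁ * v₁ + v₂ * v₂ + v₃ * v₃ = -1)
    (h : a * v₀ = b * v₁ + c * v₂ + d * v₃) : a ^ 2 ≤ b ^ 2 + c ^ 2 + d ^ 2 := by
  have hpos : 0 < v₀ ^ 2 := by nlinarith [sq_nonneg v₁, sq_nonneg v₂, sq_nonneg v₃]
  have hcs : (a * v₀) ^ 2 ≤ (b ^ 2 + c ^ 2 + d ^ 2) * (v₁ ^ 2 + v₂ ^ 2 + v₃ ^ 2) := by
    rw [h]
    nlinarith [sq_nonneg (b * v₂ - c * v₁), sq_nonneg (b * v₃ - d * v₁),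
      sq_nonneg (c * v₃ - d * v₂)]
  refine le_of_mul_le_mul_right ?_ hpos
  nlinarith [sq_nonneg b, sq_nonneg c, sq_nonneg d]

theorem maxwellMomentum_inner_observer_nonpos (F : Fin 4 → Fin 4 → ℝ)
    (hF : ∀ α β, F α β = -F β α) (v : Fin 4 → ℝ)
    (hv : ∑ α, ∑ β, η α β * v α * v β = -1) :
    ∑ α, ∑ β, η α β * maxwellMomentum F v α * v β ≤ 0 := by
  have h00 : F 0 0 = 0 := by linarith [hF 0 0]
  have h11 : F 1 1 = 0 := by linarith [hF 1 1]
  have h22 : F 2 2 = 0 := by linarith [hF 2 2]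
  have h33 : F 3 3 = 0 := by linarith [hF 3 3]
  rw [sum_eta_mul_mul] at hv ⊢
  have electric := sq_le_of_orthogonal_timelike hv
    (a := F 0 1 * v 1 + F 0 2 * v 2 + F 0 3 * v 3)
    (b := F 0 1 * v 0 - F 1 2 * v 2 - F 1 3 * v 3)
    (c := F 0 2 * v 0 + F 1 2 * v 1 - F 2 3 * v 3)
    (d := F 0 3 * v 0 + F 1 3 * v 1 + F 2 3 * v 2) (by ring)
  have magnetic := sq_le_of_orthogonal_timelike hv
    (a := F 2 3 * v 1 - F 1 3 * v 2 + F 1 2 * v 3)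
    (b := F 2 3 * v 0 + F 0 3 * v 2 - F 0 2 * v 3)
    (c := -F 1 3 * v 0 - F 0 3 * v 1 + F 0 1 * v 3)
    (d := F 1 2 * v 0 + F 0 2 * v 1 - F 0 1 * v 2) (by ring)
  simp [maxwellMomentum, dualForm_eq F hF, Fin.sum_univ_four, η, h00, h11, h22, h33,
    hF 1 0, hF 2 0, hF 3 0, hF 2 1, hF 3 1, hF 3 2]
  linarith

/-- The components in the frame boosted to `v` reproduce the Minkowski product of covectors
annihilated by `v`. -/
theorem boosted_components_mul (v f g : Fin 4 → ℝ)
    (hv : ∑ α, ∑ β, η α β * v α * v β = -1) (hv0 : 0 < v 0)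
    (hf : ∑ α, v α * f α = 0) (hg : ∑ α, v α * g α = 0) :
    ∑ α, ∑ β, η α β * (f α * g β) =
      ∑ j : Fin 3, (f j.succ + v j.succ / (1 + v 0) * f 0) *
        (g j.succ + v j.succ / (1 + v 0) * g 0) := by
  rw [sum_eta_mul_mul] at hv
  rw [sum_eta_mul]
  simp only [Fin.sum_univ_four, Fin.sum_univ_three] at *
  have h : (1 + v 0) ≠ 0 := by positivity
  simp
  field_simp
  grind

/-- The 2-forms `W_{αμγν} v^γ`, with `ν` a spatial index of the frame boosted to `v`. -/
noncomputable def boostedForm (W : Fin 4 → Fin 4 → Fin 4 → Fin 4 → ℝ) (v : Fin 4 → ℝ)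
    (j : Fin 3) (α μ : Fin 4) : ℝ :=
  ∑ γ, W α μ γ j.succ * v γ + v j.succ / (1 + v 0) * ∑ γ, W α μ γ 0 * v γ

theorem boostedForm_antisymm {W : Fin 4 → Fin 4 → Fin 4 → Fin 4 → ℝ}
    (h : ∀ α β γ δ, W α β γ δ = -W β α γ δ) (v : Fin 4 → ℝ) (j : Fin 3) (α β : Fin 4) :
    boostedForm W v j α β = -boostedForm W v j β α := by
  simp only [boostedForm, h α β, neg_mul, Finset.sum_neg_distrib, mul_neg, neg_add]

theorem dualForm_boostedForm (W : Fin 4 → Fin 4 → Fin 4 → Fin 4 → ℝ)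
    (h : ∀ α β γ δ, W α β γ δ = -W β α γ δ) (v : Fin 4 → ℝ) (j : Fin 3) :
    dualForm (boostedForm W v j) = boostedForm (dual W) v j := by
  rw [dualForm_eq _ (boostedForm_antisymm h v j)]
  funext α μ
  simp only [boostedForm, dual_eq_dualForm, dualForm_eq _ fun α β => h α β _ _]
  fin_cases α <;> fin_cases μ <;> simp [Fin.sum_univ_four] <;> ring

theorem sum_eta_mul_contract (A B : Fin 4 → Fin 4 → ℝ) (v : Fin 4 → ℝ) :
    ∑ ν, ∑ ν', η ν ν' * ((∑ γ, A γ ν * v γ) * ∑ δ, B δ ν' * v δ) =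
      ∑ γ, ∑ δ, (∑ ν, ∑ ν', η ν ν' * (A γ ν * B δ ν')) * v γ * v δ := by
  simp only [sum_eta_mul]
  simp only [Fin.sum_univ_four]
  ring

theorem sum_contract_eq (W : Fin 4 → Fin 4 → Fin 4 → Fin 4 → ℝ)
    (h : ∀ α β γ δ, W α β γ δ = -W α β δ γ) (v : Fin 4 → ℝ)
    (hv : ∑ α, ∑ β, η α β * v α * v β = -1) (hv0 : 0 < v 0) (α μ β μ' : Fin 4) :
    ∑ ν, ∑ ν', η ν ν' * ((∑ γ, W α μ γ ν * v γ) * ∑ δ, W β μ' δ ν' * v δ) =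
      ∑ j, boostedForm W v j α μ * boostedForm W v j β μ' := by
  have ann : ∀ α μ, ∑ ν, v ν * ∑ γ, W α μ γ ν * v γ = 0 := fun α μ => by
    simp only [Fin.sum_univ_four]
    grind
  exact boosted_components_mul v _ _ hv hv0 (ann α μ) (ann β μ')

theorem IsWeylCandidate.supermomentum_eq {W : Fin 4 → Fin 4 → Fin 4 → Fin 4 → ℝ}
    (hW : IsWeylCandidate W) (v : Fin 4 → ℝ)
    (hv : ∑ α, ∑ β, η α β * v α * v β = -1) (hv0 : 0 < v 0) (α : Fin 4) :
    supermomentum W v α = ∑ j, maxwellMomentum (boostedForm W v j) v α := by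
  have hdual : ∀ α β γ δ, dual W α β γ δ = -dual W α β δ γ := fun α β γ δ => by
    rw [dual, dual, ← mul_neg]
    simp only [← Finset.sum_neg_distrib, hW.2.1 _ _ γ δ, mul_neg]
  have hBR : ∀ α' β, ∑ γ, ∑ δ, BR W α' β γ δ * v γ * v δ = ∑ μ, ∑ μ', η μ μ' *
      ∑ j, (boostedForm W v j α' μ * boostedForm W v j β μ' +
        boostedForm (dual W) v j α' μ * boostedForm (dual W) v j β μ') := fun α' β => by
    simp only [Finset.sum_add_distrib, ← sum_contract_eq W hW.2.1 v hv hv0,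
      ← sum_contract_eq (dual W) hdual v hv hv0, sum_eta_mul_contract]
    have hcomp : ∀ γ δ, BR W α' β γ δ = ∑ μ, ∑ μ', η μ μ' *
        (∑ ν, ∑ ν', η ν ν' * (W α' μ γ ν * W β μ' δ ν') +
          ∑ ν, ∑ ν', η ν ν' * (dual W α' μ γ ν * dual W β μ' δ ν')) := fun γ δ => by
      simp only [BR, hW.2.2.1 δ, hW.dual_pair_symm_s7 δ, mul_assoc, mul_add, Finset.mul_sum,
        Finset.sum_add_distrib]
    simp only [hcomp, sum_eta_mul (fun _ _ => _ + _), add_mul, neg_mul, neg_add,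
      Finset.sum_add_distrib, Finset.sum_neg_distrib]
  have hsum : supermomentum W v α =
      -∑ α', ∑ β, η α α' * v β * ∑ γ, ∑ δ, BR W α' β γ δ * v γ * v δ := by
    simp only [supermomentum, Finset.mul_sum]
    refine congrArg _ (Finset.sum_congr rfl fun _ _ => Finset.sum_congr rfl fun _ _ =>
      Finset.sum_congr rfl fun _ _ => Finset.sum_congr rfl fun _ _ => by ring)
  rw [hsum]
  simp only [hBR, maxwellMomentum, dualForm_boostedForm W hW.1, Fin.sum_univ_three, ← neg_add,
    ← Finset.sum_add_distrib, Finset.mul_sum]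
  refine congrArg _ (Finset.sum_congr rfl fun _ _ => Finset.sum_congr rfl fun _ _ =>
    Finset.sum_congr rfl fun _ _ => Finset.sum_congr rfl fun _ _ => by ring)

/-- Future-pointing causal vectors have nonpositive Minkowski products. -/
theorem sum_eta_mul_nonpos_of_causal_future (v P Q : Fin 4 → ℝ)
    (hv : ∑ α, ∑ β, η α β * v α * v β = -1) (hv0 : 0 < v 0)
    (hP : ∑ α, ∑ β, η α β * P α * P β ≤ 0) (hPv : ∑ α, ∑ β, η α β * P α * v β ≤ 0)
    (hQ : ∑ α, ∑ β, η α β * Q α * Q β ≤ 0) (hQv : ∑ α, ∑ β, η α β * Q α * v β ≤ 0) :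
    ∑ α, ∑ β, η α β * P α * Q β ≤ 0 := by
  have cs : ∀ x y : Fin 4 → ℝ, (x 1 * y 1 + x 2 * y 2 + x 3 * y 3) ^ 2 ≤
      (x 1 ^ 2 + x 2 ^ 2 + x 3 ^ 2) * (y 1 ^ 2 + y 2 ^ 2 + y 3 ^ 2) := fun x y => by
    nlinarith [sq_nonneg (x 1 * y 2 - x 2 * y 1), sq_nonneg (x 1 * y 3 - x 3 * y 1),
      sq_nonneg (x 2 * y 3 - x 3 * y 2)]
  rw [sum_eta_mul_mul] at *
  have time_nonneg : ∀ x : Fin 4 → ℝ,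
      -(x 0 * x 0) + x 1 * x 1 + x 2 * x 2 + x 3 * x 3 ≤ 0 →
      -(x 0 * v 0) + x 1 * v 1 + x 2 * v 2 + x 3 * v 3 ≤ 0 → 0 ≤ x 0 := by
    intro x hx hxv
    by_contra! hneg
    have h1 : 0 < -(x 0) * v 0 := mul_pos (by linarith) hv0
    have h2 : (x 0 * v 0) ^ 2 ≤ (x 1 * v 1 + x 2 * v 2 + x 3 * v 3) ^ 2 := by nlinarith
    have h3 : (x 1 ^ 2 + x 2 ^ 2 + x 3 ^ 2) * (v 1 ^ 2 + v 2 ^ 2 + v 3 ^ 2) ≤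
        x 0 ^ 2 * (v 0 ^ 2 - 1) :=
      mul_le_mul (by linarith) (by linarith) (by positivity) (by positivity)
    nlinarith [cs x v]
  have h3 : (P 1 ^ 2 + P 2 ^ 2 + P 3 ^ 2) * (Q 1 ^ 2 + Q 2 ^ 2 + Q 3 ^ 2) ≤
      P 0 ^ 2 * Q 0 ^ 2 :=
    mul_le_mul (by linarith) (by linarith) (by positivity) (by positivity)
  have := abs_le_of_sq_le_sq' ((cs P Q).trans (h3.trans_eq (mul_pow _ _ 2).symm))
    (mul_nonneg (time_nonneg P hP hPv) (time_nonneg Q hQ hQv))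
  linarith [this.2]

/-- For a unit future-pointing timelike observer `v`, the supermomentum of the
Bel–Robinson tensor is causal and future-pointing. -/
theorem supermomentum_causal_future
    (W : Fin 4 → Fin 4 → Fin 4 → Fin 4 → ℝ) (hW : IsWeylCandidate W)
    (v : Fin 4 → ℝ)
    (hv : ∑ α, ∑ β, η α β * v α * v β = -1) (hv0 : 0 < v 0) :
    (∑ α, ∑ β, η α β * supermomentum W v α * supermomentum W v β ≤ 0) ∧
    (∑ α, ∑ β, η α β * supermomentum W v α * v β ≤ 0) := by
  have hF := boostedForm_antisymm hW.1 v
  have hself := fun j => maxwellMomentum_inner_self_nonpos _ (hF j) v hv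
  have hobs := fun j => maxwellMomentum_inner_observer_nonpos _ (hF j) v hv
  have hcross := fun i j => sum_eta_mul_nonpos_of_causal_future v _ _ hv hv0
    (hself i) (hobs i) (hself j) (hobs j)
  simp only [hW.supermomentum_eq v hv hv0]
  constructor
  · have h := Finset.sum_nonpos fun i (_ : i ∈ Finset.univ) =>
      Finset.sum_nonpos fun j (_ : j ∈ Finset.univ) => hcross i j
    simp only [sum_eta_mul_mul, Fin.sum_univ_three] at h ⊢
    linarith
  · have h := Finset.sum_nonpos fun j (_ : j ∈ Finset.univ) => hobs j
    simp only [sum_eta_mul_mul, Fin.sum_univ_three] at h ⊢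
    linarith
end

section
/- Let W be a Weyl candidate on Minkowski ℝ⁴ and T its Bel–Robinson tensor, and define the electric and magnetic parts D_{ab} := W_{0a0b} and C_{ab} := (*W)_{0a0b} for a, b ∈ {1,2,3}. Then the super-Poynting vector with respect to the unit timelike vector e₀ vanishes if and only if the matrices C and D commute: (T_{a000} = 0 for all a ∈ {1,2,3}) ↔ C·D = D·C. -/
/-- The electric part `D_{ab} = W_{0a0b}` of a Weyl candidate with respect to `e₀`. -/
noncomputable def electricPart (W : Fin 4 → Fin 4 → Fin 4 → Fin 4 → ℝ) :
    Matrix (Fin 3) (Fin 3) ℝ :=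
  Matrix.of fun a b => W 0 a.succ 0 b.succ

/-- The magnetic part `C_{ab} = (*W)_{0a0b}` of a Weyl candidate with respect to `e₀`. -/
noncomputable def magneticPart (W : Fin 4 → Fin 4 → Fin 4 → Fin 4 → ℝ) :
    Matrix (Fin 3) (Fin 3) ℝ :=
  Matrix.of fun a b => dual W 0 a.succ 0 b.succ

/-- An array antisymmetric in its first two indices vanishes when they agree. -/
theorem diag_eq_zero_of_antisymm {W : Fin 4 → Fin 4 → Fin 4 → Fin 4 → ℝ}
    (h : ∀ α β γ δ, W α β γ δ = - W β α γ δ) (α γ δ : Fin 4) : W α α γ δ = 0 :=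
  self_eq_neg.mp (h α α γ δ)

theorem dual_zero_one {W : Fin 4 → Fin 4 → Fin 4 → Fin 4 → ℝ}
    (h : ∀ α β γ δ, W α β γ δ = - W β α γ δ) (γ δ : Fin 4) :
    dual W 0 1 γ δ = W 2 3 γ δ := by
  simp [dual, Fin.sum_univ_four, eps4, η]
  linarith [h 2 3 γ δ]

theorem dual_zero_two {W : Fin 4 → Fin 4 → Fin 4 → Fin 4 → ℝ}
    (h : ∀ α β γ δ, W α β γ δ = - W β α γ δ) (γ δ : Fin 4) :
    dual W 0 2 γ δ = W 3 1 γ δ := by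
  simp [dual, Fin.sum_univ_four, eps4, η]
  linarith [h 3 1 γ δ]

theorem dual_zero_three {W : Fin 4 → Fin 4 → Fin 4 → Fin 4 → ℝ}
    (h : ∀ α β γ δ, W α β γ δ = - W β α γ δ) (γ δ : Fin 4) :
    dual W 0 3 γ δ = W 1 2 γ δ := by
  simp [dual, Fin.sum_univ_four, eps4, η]
  linarith [h 1 2 γ δ]

theorem dual_two_three {W : Fin 4 → Fin 4 → Fin 4 → Fin 4 → ℝ}
    (h : ∀ α β γ δ, W α β γ δ = - W β α γ δ) (γ δ : Fin 4) :
    dual W 2 3 γ δ = -W 0 1 γ δ := by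
  simp [dual, Fin.sum_univ_four, eps4, η]
  linarith [h 0 1 γ δ]

theorem dual_three_one {W : Fin 4 → Fin 4 → Fin 4 → Fin 4 → ℝ}
    (h : ∀ α β γ δ, W α β γ δ = - W β α γ δ) (γ δ : Fin 4) :
    dual W 3 1 γ δ = -W 0 2 γ δ := by
  simp [dual, Fin.sum_univ_four, eps4, η]
  linarith [h 0 2 γ δ]

theorem dual_one_two {W : Fin 4 → Fin 4 → Fin 4 → Fin 4 → ℝ}
    (h : ∀ α β γ δ, W α β γ δ = - W β α γ δ) (γ δ : Fin 4) :
    dual W 1 2 γ δ = -W 0 3 γ δ := by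
  simp [dual, Fin.sum_univ_four, eps4, η]
  linarith [h 0 3 γ δ]

/-- The Hodge dual is antisymmetric in its first two indices. -/
theorem dual_antisymm (W : Fin 4 → Fin 4 → Fin 4 → Fin 4 → ℝ) (α β γ δ : Fin 4) :
    dual W α β γ δ = -dual W β α γ δ := by
  have heps : ∀ μ ν, eps4 α β μ ν = -eps4 β α μ ν := fun μ ν => by
    unfold eps4
    ring
  simp only [dual, heps, neg_mul, Finset.sum_neg_distrib, mul_neg]

/-- The Hodge dual inherits antisymmetry in the last two indices. -/
theorem dual_antisymm_right {W : Fin 4 → Fin 4 → Fin 4 → Fin 4 → ℝ}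
    (h : ∀ α β γ δ, W α β γ δ = - W α β δ γ) (α β γ δ : Fin 4) :
    dual W α β γ δ = -dual W α β δ γ := by
  simp only [dual, h _ _ γ δ, mul_neg, Finset.sum_neg_distrib]

theorem electricPart_apply_comm {W : Fin 4 → Fin 4 → Fin 4 → Fin 4 → ℝ}
    (hW : IsWeylCandidate W) (a b : Fin 3) : electricPart W a b = electricPart W b a :=
  hW.2.2.1 0 a.succ 0 b.succ

theorem magneticPart_isSymm {W : Fin 4 → Fin 4 → Fin 4 → Fin 4 → ℝ}
    (hW : IsWeylCandidate W) : (magneticPart W).IsSymm := by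
  obtain ⟨h1, h2, -, -, h5⟩ := hW
  have trace (β : Fin 4) : -W 0 β 0 0 + W 1 β 1 0 + W 2 β 2 0 + W 3 β 3 0 = 0 := by
    simpa [Fin.sum_univ_four, η] using h5 β 0
  have hd := diag_eq_zero_of_antisymm h1
  have hd' (α β γ : Fin 4) : W α β γ γ = 0 := self_eq_neg.mp (h2 α β γ γ)
  have t1 := trace 1
  have t2 := trace 2
  have t3 := trace 3
  simp only [hd, hd', neg_zero, zero_add, add_zero] at t1 t2 t3
  refine Matrix.IsSymm.ext fun i j => ?_
  fin_cases i <;> fin_cases j <;>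
    simp [magneticPart, dual_zero_one h1, dual_zero_two h1, dual_zero_three h1] <;>
    linarith [h1 1 3 1 0, h2 3 1 1 0, h2 2 3 2 0, h2 1 2 1 0, h1 3 2 3 0, h2 2 3 3 0,
      h1 2 1 2 0, h2 1 2 2 0, h2 3 1 3 0]

/-- The super-Poynting vector is dual to the commutator of the magnetic and electric parts. -/
theorem superPoynting_eq_commutator {W : Fin 4 → Fin 4 → Fin 4 → Fin 4 → ℝ}
    (hW : IsWeylCandidate W) (a : Fin 3) :
    BR W a.succ 0 0 0 =
      (magneticPart W * electricPart W - electricPart W * magneticPart W) (a + 2) (a + 1) -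
      (magneticPart W * electricPart W - electricPart W * magneticPart W) (a + 1) (a + 2) := by
  have h := hW.1
  have hd := diag_eq_zero_of_antisymm h
  have hd' := diag_eq_zero_of_antisymm (dual_antisymm W)
  have hz (α β γ : Fin 4) : W α β γ γ = 0 := self_eq_neg.mp (hW.2.1 α β γ γ)
  have hz' (α β γ : Fin 4) : dual W α β γ γ = 0 :=
    self_eq_neg.mp (dual_antisymm_right hW.2.1 α β γ γ)
  fin_cases a <;>
    simp [BR, Fin.sum_univ_four, η, Matrix.mul_apply, Fin.sum_univ_three, electricPart,
      magneticPart, hd, hd', hz, hz', h 2 1, h 3 2, h 1 3, dual_antisymm W 2 1,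
      dual_antisymm W 3 2, dual_antisymm W 1 3, dual_zero_one h, dual_zero_two h,
      dual_zero_three h, dual_one_two h, dual_two_three h, dual_three_one h] <;>
    ring

/-- The super-Poynting vector `T_{a000}` with respect to `e₀` vanishes iff the
electric and magnetic parts of the Weyl candidate commute. -/
theorem superPoynting_eq_zero_iff_commute
    (W : Fin 4 → Fin 4 → Fin 4 → Fin 4 → ℝ) (hW : IsWeylCandidate W) :
    (∀ a : Fin 3, BR W a.succ 0 0 0 = 0) ↔
      magneticPart W * electricPart W = electricPart W * magneticPart W := by
  set C := magneticPart W with hC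
  set D := electricPart W with hD
  have hCs : C.transpose = C := magneticPart_isSymm hW
  have hDs : D.transpose = D := by
    ext i j
    exact electricPart_apply_comm hW j i
  have anti (i j : Fin 3) : (C * D - D * C) i j = -(C * D - D * C) j i := by
    have : (C * D - D * C).transpose = -(C * D - D * C) := by
      rw [Matrix.transpose_sub, Matrix.transpose_mul, Matrix.transpose_mul, hCs, hDs, neg_sub]
    exact congrFun (congrFun this j) i
  rw [← sub_eq_zero]
  constructor
  · intro h
    have key (a : Fin 3) : (C * D - D * C) (a + 2) (a + 1) = 0 := by
      have := superPoynting_eq_commutator hW a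
      rw [h a, ← hC, ← hD, anti (a + 1)] at this
      linarith
    ext i j
    have k0 := key 0
    have k1 := key 1
    have k2 := key 2
    have := anti i j
    fin_cases i <;> fin_cases j <;> simp at k0 k1 k2 this ⊢ <;> linarith
  · intro h a
    rw [superPoynting_eq_commutator hW a, ← hC, ← hD, h]
    simp
end
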